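/- arXiv:1301.0247 — 6 statements merged into one kernel-verified Lean document; each statement's English description precedes it below -/
import Mathlib

section
/- Let W = {w(s) : s ∈ Σ} be a normalized tight continuous frame in H and let Ω be a bounded subset of H. Then Ω is relatively compact in H if and only if the family φ_W(Ω) is K(Σ)-tight in L²(Σ,μ); that is, if and only if for every ε > 0 there exists a compact set L ⊆ Σ such that sup_{u ∈ Ω} ( ∫_{Σ∖L} |⟨u, w(s)⟩|² dμ(s) )^{1/2} ≤ ε. -/
open MeasureTheory ComplexConjugate
open scoped ComplexInnerProductSpace
open Filter Topology

section ContinuousFrame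

variable {H : Type*} [NormedAddCommGroup H] [InnerProductSpace ℂ H]

theorem exists_subseq_tendsto_inner_of_norm_le [CompleteSpace H]
    [TopologicalSpace.SeparableSpace H] {x : ℕ → H} {R : ℝ} (hx : ∀ n, ‖x n‖ ≤ R) :
    ∃ a : H, ∃ φ : ℕ → ℕ, StrictMono φ ∧
      ∀ v : H, Tendsto (fun n => ⟪v, x (φ n)⟫) atTop (𝓝 ⟪v, a⟫) := by
  obtain ⟨f, -, φ, hφ, hf⟩ := WeakDual.isSeqCompact_closedBall ℂ H 0 R
    (x := fun n => StrongDual.toWeakDual (InnerProductSpace.toDual ℂ H (x n)))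
    (fun n => by simpa using hx n)
  refine ⟨(InnerProductSpace.toDual ℂ H).symm (WeakDual.toStrongDual f), φ, hφ, fun v => ?_⟩
  have h := tendsto_iff_forall_eval_tendsto_topDualPairing.1 hf v
  have hc := (Complex.continuous_conj.tendsto _).comp h
  convert hc using 1
  · ext n
    exact (inner_conj_symm v (x (φ n))).symm
  · rw [← inner_conj_symm, InnerProductSpace.toDual_symm_apply]
    rfl

variable {X : Type*} {w : X → H}

theorem IsCompact.exists_norm_le_of_continuous_inner [TopologicalSpace X] [CompleteSpace H]
    (hw : ∀ u : H, Continuous fun s => ⟪w s, u⟫) {L : Set X} (hL : IsCompact L) :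
    ∃ C, ∀ s ∈ L, ‖w s‖ ≤ C := by
  obtain ⟨C, hC⟩ := banach_steinhaus (g := fun s : L => innerSL ℂ (w s)) fun u => by
    obtain ⟨C, hC⟩ := hL.exists_bound_of_continuousOn (hw u).continuousOn
    exact ⟨C, fun s => hC s s.2⟩
  exact ⟨C, fun s hs => by simpa using hC ⟨s, hs⟩⟩

variable [MeasurableSpace X] {μ : Measure X}

theorem integral_norm_inner_sq_of_frame
    (hframe : ∀ u v : H, ⟪u, v⟫ = ∫ s, conj ⟪w s, u⟫ * ⟪w s, v⟫ ∂μ) (u : H) :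
    ∫ s, ‖⟪w s, u⟫‖ ^ 2 ∂μ = ‖u‖ ^ 2 := by
  have h := hframe u u
  simp only [Complex.conj_mul'] at h
  rw [inner_self_eq_norm_sq_to_K] at h
  have h' : ∫ s, ((‖⟪w s, u⟫‖ : ℂ)) ^ 2 ∂μ = ((∫ s, ‖⟪w s, u⟫‖ ^ 2 ∂μ : ℝ) : ℂ) := by
    rw [← integral_complex_ofReal]
    simp
  rw [h'] at h
  exact Complex.ofReal_injective (by rw [← h]; simp)

theorem integrable_norm_inner_sq_of_frame
    (hframe : ∀ u v : H, ⟪u, v⟫ = ∫ s, conj ⟪w s, u⟫ * ⟪w s, v⟫ ∂μ) (u : H) :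
    Integrable (fun s => ‖⟪w s, u⟫‖ ^ 2) μ := by
  by_cases hu : u = 0
  · simp [hu]
  · refine Integrable.of_integral_ne_zero ?_
    rw [integral_norm_inner_sq_of_frame hframe]
    simpa using hu

theorem setIntegral_norm_inner_sq_le_of_frame
    (hframe : ∀ u v : H, ⟪u, v⟫ = ∫ s, conj ⟪w s, u⟫ * ⟪w s, v⟫ ∂μ) (A : Set X) (u : H) :
    ∫ s in A, ‖⟪w s, u⟫‖ ^ 2 ∂μ ≤ ‖u‖ ^ 2 := by
  rw [← integral_norm_inner_sq_of_frame hframe]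
  exact setIntegral_le_integral (integrable_norm_inner_sq_of_frame hframe u)
    (.of_forall fun s => by positivity)

theorem setIntegral_norm_inner_add_sq_le_of_frame
    (hframe : ∀ u v : H, ⟪u, v⟫ = ∫ s, conj ⟪w s, u⟫ * ⟪w s, v⟫ ∂μ) (A : Set X) (u v : H) :
    ∫ s in A, ‖⟪w s, u + v⟫‖ ^ 2 ∂μ ≤
      2 * ∫ s in A, ‖⟪w s, u⟫‖ ^ 2 ∂μ + 2 * ∫ s in A, ‖⟪w s, v⟫‖ ^ 2 ∂μ := by
  have hi := fun u => (integrable_norm_inner_sq_of_frame hframe u).integrableOn (s := A)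
  rw [← integral_const_mul, ← integral_const_mul,
    ← integral_add ((hi u).const_mul 2) ((hi v).const_mul 2)]
  refine integral_mono (hi _) (((hi u).const_mul 2).add ((hi v).const_mul 2)) fun s => ?_
  simp only [inner_add_right]
  have h := norm_add_le ⟪w s, u⟫ ⟪w s, v⟫
  nlinarith [norm_nonneg (⟪w s, u⟫ + ⟪w s, v⟫), sq_nonneg (‖⟪w s, u⟫‖ - ‖⟪w s, v⟫‖)]

theorem setIntegral_norm_inner_sq_le_of_mem_closure
    (hframe : ∀ u v : H, ⟪u, v⟫ = ∫ s, conj ⟪w s, u⟫ * ⟪w s, v⟫ ∂μ)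
    {A : Set X} {K : Set H} {ε : ℝ} (hε : 0 < ε)
    (hK : ∀ u ∈ K, ∫ s in A, ‖⟪w s, u⟫‖ ^ 2 ∂μ ≤ ε) {u : H} (hu : u ∈ closure K) :
    ∫ s in A, ‖⟪w s, u⟫‖ ^ 2 ∂μ ≤ 4 * ε := by
  obtain ⟨y, hy, huy⟩ := Metric.mem_closure_iff.1 hu (√ε) (by positivity)
  have h := setIntegral_norm_inner_add_sq_le_of_frame hframe A y (u - y)
  have hdiff := setIntegral_norm_inner_sq_le_of_frame hframe A (u - y)
  rw [dist_eq_norm, Real.lt_sqrt (norm_nonneg _)] at huy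
  rw [add_sub_cancel] at h
  linarith [hK y hy]

variable [TopologicalSpace X] [T2Space X] [BorelSpace X]

theorem exists_isCompact_setIntegral_compl_lt [SigmaCompactSpace X] {f : X → ℝ}
    (hf : Integrable f μ) {ε : ℝ} (hε : 0 < ε) :
    ∃ L : Set X, IsCompact L ∧ ∫ s in Lᶜ, f s ∂μ < ε := by
  have h := tendsto_setIntegral_of_antitone (μ := μ) (f := f)
    (s := fun n => (compactCovering X n)ᶜ)
    (fun n => (isCompact_compactCovering X n).measurableSet.compl)
    (fun m n hmn => Set.compl_subset_compl.2 (compactCovering_subset X hmn))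
    ⟨0, hf.integrableOn⟩
  rw [← Set.compl_iUnion, iUnion_compactCovering, Set.compl_univ, setIntegral_empty] at h
  obtain ⟨n, hn⟩ := (h.eventually (gt_mem_nhds hε)).exists
  exact ⟨_, isCompact_compactCovering X n, hn⟩

theorem IsCompact.tendsto_setIntegral_norm_inner_sq [CompleteSpace H]
    [IsFiniteMeasureOnCompacts μ] (hw : ∀ u : H, Continuous fun s => ⟪w s, u⟫)
    {L : Set X} (hL : IsCompact L) {x : ℕ → H} {R : ℝ} (hx : ∀ n, ‖x n‖ ≤ R)
    (hx0 : ∀ v : H, Tendsto (fun n => ⟪v, x n⟫) atTop (𝓝 0)) :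
    Tendsto (fun n => ∫ s in L, ‖⟪w s, x n⟫‖ ^ 2 ∂μ) atTop (𝓝 0) := by
  obtain ⟨C, hC⟩ := hL.exists_norm_le_of_continuous_inner hw
  rw [← integral_zero X ℝ (μ := μ.restrict L)]
  refine tendsto_integral_of_dominated_convergence (fun _ => (C * R) ^ 2)
    (fun n => ((hw (x n)).norm.pow 2).aestronglyMeasurable)
    (integrableOn_const hL.measure_lt_top.ne) (fun n => ?_) (.of_forall fun s => ?_)
  · filter_upwards [ae_restrict_mem hL.measurableSet] with s hs
    rw [norm_pow, norm_norm]
    gcongr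
    exact (norm_inner_le_norm _ _).trans
      (mul_le_mul (hC s hs) (hx n) (norm_nonneg _) ((norm_nonneg _).trans (hC s hs)))
  · simpa using (hx0 (w s)).norm.pow 2

theorem isCompact_of_setIntegral_compl_le [CompleteSpace H]
    [TopologicalSpace.SeparableSpace H] [SigmaCompactSpace X] [IsFiniteMeasureOnCompacts μ]
    (hw : ∀ u : H, Continuous fun s => ⟪w s, u⟫)
    (hframe : ∀ u v : H, ⟪u, v⟫ = ∫ s, conj ⟪w s, u⟫ * ⟪w s, v⟫ ∂μ)
    {K : Set H} (hK : IsClosed K) (hb : Bornology.IsBounded K)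
    (ht : ∀ ε > (0 : ℝ), ∃ L : Set X, IsCompact L ∧
      ∀ u ∈ K, ∫ s in Lᶜ, ‖⟪w s, u⟫‖ ^ 2 ∂μ ≤ ε) :
    IsCompact K := by
  refine isCompact_iff_isSeqCompact.2 fun x hx => ?_
  obtain ⟨R, hR⟩ := hb.exists_norm_le
  obtain ⟨a, φ, hφ, ha⟩ := exists_subseq_tendsto_inner_of_norm_le fun n => hR _ (hx n)
  suffices h : Tendsto (x ∘ φ) atTop (𝓝 a) from
    ⟨a, hK.mem_of_tendsto h (.of_forall fun n => hx _), φ, hφ, h⟩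
  suffices h : Tendsto (fun n => ‖x (φ n) + -a‖ ^ 2) atTop (𝓝 0) by
    rw [tendsto_iff_norm_sub_tendsto_zero]
    simpa [← sub_eq_add_neg] using h.sqrt
  refine tendsto_order.2 ⟨fun b hb' => .of_forall fun n => hb'.trans_le (by positivity),
    fun ε hε => ?_⟩
  obtain ⟨L₁, hL₁, h₁⟩ := ht (ε / 8) (by positivity)
  obtain ⟨L₂, hL₂, h₂⟩ := exists_isCompact_setIntegral_compl_lt
    (integrable_norm_inner_sq_of_frame hframe (-a)) (show 0 < ε / 8 by positivity)
  have hL := hL₁.union hL₂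
  have hlim := hL.tendsto_setIntegral_norm_inner_sq (μ := μ) hw
    (x := fun n => x (φ n) + -a) (R := R + ‖a‖)
    (fun n => (norm_add_le _ _).trans (by rw [norm_neg]; gcongr; exact hR _ (hx _)))
    (fun v => by simpa [inner_add_right] using (ha v).add_const (-⟪v, a⟫))
  filter_upwards [hlim.eventually (gt_mem_nhds (show 0 < ε / 2 by positivity))] with n hn
  have hmono : ∀ (u : H) {A : Set X}, A ⊆ L₁ ∪ L₂ →
      ∫ s in (L₁ ∪ L₂)ᶜ, ‖⟪w s, u⟫‖ ^ 2 ∂μ ≤ ∫ s in Aᶜ, ‖⟪w s, u⟫‖ ^ 2 ∂μ := fun u A hA =>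
    setIntegral_mono_set (integrable_norm_inner_sq_of_frame hframe u).integrableOn
      (.of_forall fun s => by positivity) (Set.compl_subset_compl.2 hA).eventuallyLE
  rw [← integral_norm_inner_sq_of_frame hframe,
    ← integral_add_compl hL.measurableSet (integrable_norm_inner_sq_of_frame hframe _)]
  have h := setIntegral_norm_inner_add_sq_le_of_frame hframe (L₁ ∪ L₂)ᶜ (x (φ n)) (-a)
  have hx₁ := (hmono (x (φ n)) Set.subset_union_left).trans (h₁ _ (hx _))
  have hx₂ := (hmono (-a) Set.subset_union_right).trans_lt h₂
  linarith

theorem TotallyBounded.exists_isCompact_setIntegral_compl_le [SigmaCompactSpace X]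
    (hframe : ∀ u v : H, ⟪u, v⟫ = ∫ s, conj ⟪w s, u⟫ * ⟪w s, v⟫ ∂μ)
    {K : Set H} (hK : TotallyBounded K) {ε : ℝ} (hε : 0 < ε) :
    ∃ L : Set X, IsCompact L ∧ ∀ u ∈ K, ∫ s in Lᶜ, ‖⟪w s, u⟫‖ ^ 2 ∂μ ≤ ε := by
  obtain ⟨t, ht, hcov⟩ := Metric.totallyBounded_iff.1 hK (√(ε / 4)) (by positivity)
  choose L hL hLε using fun u => exists_isCompact_setIntegral_compl_lt
    (integrable_norm_inner_sq_of_frame hframe u) (show 0 < ε / 4 by positivity)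
  refine ⟨⋃ y ∈ t, L y, ht.isCompact_biUnion fun y _ => hL y, fun u hu => ?_⟩
  obtain ⟨y, hy, huy⟩ := Set.mem_iUnion₂.1 (hcov hu)
  have hmono := setIntegral_mono_set
    (integrable_norm_inner_sq_of_frame hframe y).integrableOn
    (.of_forall fun s => by positivity)
    (Set.compl_subset_compl.2 (Set.subset_biUnion_of_mem (u := L) hy)).eventuallyLE
  have h := setIntegral_norm_inner_add_sq_le_of_frame hframe (⋃ y ∈ t, L y)ᶜ y (u - y)
  have hdiff := setIntegral_norm_inner_sq_le_of_frame hframe (⋃ y ∈ t, L y)ᶜ (u - y)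
  have hsq : ‖u - y‖ ^ 2 < ε / 4 := by
    rw [← Real.lt_sqrt (norm_nonneg _), ← dist_eq_norm]
    exact huy
  rw [add_sub_cancel] at h
  linarith [hLε y]

end ContinuousFrame



/-- Let `W = {w s : s ∈ Sp}` be a normalized tight continuous frame in a
separable complex Hilbert space `H`, indexed by a Hausdorff, locally compact, σ-compact
space `Sp` with a Radon measure `μ` (the paper's `⟨u, w s⟩`, linear in `u`, is Mathlib's
`⟪w s, u⟫`).  A bounded subset `Ω ⊆ H` is relatively compact if and only if the family
`φ_W(Ω)` is `K(Sp)`-tight in `L²(Sp, μ)`: for every `ε > 0` there is a compact `L ⊆ Sp`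
with `sup_{u ∈ Ω} ( ∫_{Sp∖L} |⟪w s, u⟫|² dμ s )^{1/2} ≤ ε`. -/
theorem statement3
    {Sp : Type*} [TopologicalSpace Sp] [T2Space Sp] [LocallyCompactSpace Sp]
    [SigmaCompactSpace Sp] [MeasurableSpace Sp] [BorelSpace Sp]
    (μ : Measure Sp) [μ.Regular]
    {H : Type*} [NormedAddCommGroup H] [InnerProductSpace ℂ H] [CompleteSpace H]
    [TopologicalSpace.SeparableSpace H]
    (w : Sp → H)
    (hw_cont : ∀ u : H, Continuous fun s => ⟪w s, u⟫)
    (hframe : ∀ u v : H, ⟪u, v⟫ = ∫ s, conj ⟪w s, u⟫ * ⟪w s, v⟫ ∂μ)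
    (Ω : Set H) (hΩ : Bornology.IsBounded Ω) :
    IsCompact (closure Ω) ↔
      ∀ ε > (0:ℝ), ∃ L : Set Sp, IsCompact L ∧
        ∀ u ∈ Ω, Real.sqrt (∫ s in Lᶜ, ‖⟪w s, u⟫‖ ^ 2 ∂μ) ≤ ε := by
  constructor
  · intro h ε hε
    obtain ⟨L, hL, hLε⟩ := (h.totallyBounded.subset
      subset_closure).exists_isCompact_setIntegral_compl_le hframe (pow_pos hε 2)
    exact ⟨L, hL, fun u hu => (Real.sqrt_le_left hε.le).2 (hLε u hu)⟩
  · intro h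
    refine isCompact_of_setIntegral_compl_le hw_cont hframe isClosed_closure hΩ.closure
      fun ε hε => ?_
    obtain ⟨L, hL, hLε⟩ := h (√(ε / 4)) (by positivity)
    refine ⟨L, hL, fun u hu => ?_⟩
    have := setIntegral_norm_inner_sq_le_of_mem_closure hframe (A := Lᶜ)
      (show 0 < ε / 4 by positivity)
      (fun v hv => (Real.sqrt_le_sqrt_iff (by positivity)).1 (hLε v hv)) hu
    linarith
end

section
/- Assume the square-integrability condition and the surjectivity assumption. Then there exists a unique unitary operator Π : L²(Σ,μ) → B₂(H) onto the Hilbert space of Hilbert–Schmidt operators on H such that Π applied to the function s ↦ ⟨π(s)u, v⟩ equals the rank-one operator ⟨·, v⟩u, for all u, v ∈ H. Moreover, for every f ∈ L²(Σ,μ) and all u', v' ∈ H one has ⟨Π(f)u', v'⟩ = ∫_Σ f(s) ⟨π(s)*u', v'⟩ dμ(s). -/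
open MeasureTheory ComplexConjugate
open scoped ComplexInnerProductSpace

section Sesquilinear

variable {H E : Type*} [NormedAddCommGroup H] [InnerProductSpace ℂ H]
  [NormedAddCommGroup E] [InnerProductSpace ℂ E]

/-- Polarization: a sesquilinear form that vanishes on the diagonal is zero. -/
theorem LinearMap.sesquilin_eq_zero_of_apply_self {V : Type*} [AddCommGroup V] [Module ℂ V]
    (B : V →ₗ⋆[ℂ] V →ₗ[ℂ] ℂ) (h : ∀ x, B x x = 0) : B = 0 := by
  ext x y
  have h1 := h (x + y)
  have h2 := h (x + Complex.I • y)
  simp only [map_add, LinearMap.add_apply, h, LinearMap.map_smulₛₗ, LinearMap.smul_apply,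
    smul_eq_mul, Complex.conj_I, RingHom.id_apply] at h1 h2
  have h3 : Complex.I * (B x y - B y x) = 0 := by linear_combination h2
  have h4 : B x y - B y x = 0 := (mul_eq_zero.mp h3).resolve_left Complex.I_ne_zero
  simp only [LinearMap.zero_apply]
  linear_combination (h1 + h4) / 2

/-- Two sesquilinear forms that agree on the diagonal are equal. -/
theorem LinearMap.sesquilin_ext_of_apply_self {V : Type*} [AddCommGroup V] [Module ℂ V]
    {B C : V →ₗ⋆[ℂ] V →ₗ[ℂ] ℂ} (h : ∀ x, B x x = C x x) : B = C :=
  sub_eq_zero.mp <| sesquilin_eq_zero_of_apply_self (B - C) fun x => by simp [h x]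

variable (Φ : H →L⋆[ℂ] H →L[ℂ] E)

/-- The inner products of a sesquilinear map `Φ` with `‖Φ v u‖ = ‖u‖ ‖v‖` factor. -/
theorem inner_apply_apply_of_norm_apply_apply (hΦ : ∀ u v, ‖Φ v u‖ = ‖u‖ * ‖v‖) (u u' v v' : H) :
    ⟪Φ v u, Φ v' u'⟫ = ⟪u, u'⟫ * ⟪v', v⟫ := by
  have key : ∀ u u' v : H, ⟪Φ v u, Φ v u'⟫ = ⟪u, u'⟫ * ⟪v, v⟫ := by
    intro u u' v
    let B : H →ₗ⋆[ℂ] H →ₗ[ℂ] ℂ := LinearMap.mk₂'ₛₗ (starRingEnd ℂ) (RingHom.id ℂ)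
      (fun u u' => ⟪Φ v u, Φ v u'⟫) (by simp) (by simp [mul_comm]) (by simp) (by simp)
    let C : H →ₗ⋆[ℂ] H →ₗ[ℂ] ℂ := LinearMap.mk₂'ₛₗ (starRingEnd ℂ) (RingHom.id ℂ)
      (fun u u' => ⟪u, u'⟫ * ⟪v, v⟫) (by simp [add_mul]) (by simp [mul_assoc, mul_left_comm])
      (by simp [add_mul]) (by simp [mul_assoc])
    have : B = C := LinearMap.sesquilin_ext_of_apply_self fun u => by
      simp only [B, C, LinearMap.mk₂'ₛₗ_apply, inner_self_eq_norm_sq_to_K, hΦ]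
      push_cast
      ring
    exact LinearMap.congr_fun₂ this u u'
  let B : H →ₗ⋆[ℂ] H →ₗ[ℂ] ℂ := LinearMap.mk₂'ₛₗ (starRingEnd ℂ) (RingHom.id ℂ)
    (fun v' v => ⟪Φ v u, Φ v' u'⟫) (by simp) (by simp) (by simp) (by simp [mul_comm])
  let C : H →ₗ⋆[ℂ] H →ₗ[ℂ] ℂ := LinearMap.mk₂'ₛₗ (starRingEnd ℂ) (RingHom.id ℂ)
    (fun v' v => ⟪u, u'⟫ * ⟪v', v⟫) (by simp [mul_add])
    (fun c x y => by simp only [inner_smul_left, smul_eq_mul]; ring) (by simp [mul_add])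
    (by simp [mul_left_comm])
  have : B = C := LinearMap.sesquilin_ext_of_apply_self fun v => key u u' v
  exact LinearMap.congr_fun₂ this v' v

variable [CompleteSpace H] [CompleteSpace E]

/-- The operators `x ↦ (Φ x)† f` attached to a sesquilinear map `Φ : H → H → E`, as a linear
function of `f : E`. -/
noncomputable def adjointOperator : E →ₗ[ℂ] (H →L[ℂ] H) where
  toFun f := LinearMap.mkContinuous
    { toFun := fun x => ContinuousLinearMap.adjoint (Φ x) f
      map_add' := by simp
      map_smul' := fun c x => by
        refine ext_inner_left ℂ fun w => ?_
        simp [ContinuousLinearMap.adjoint_inner_right, inner_smul_left, inner_smul_right] }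
    (‖Φ‖ * ‖f‖) fun x =>
        calc ‖ContinuousLinearMap.adjoint (Φ x) f‖
            ≤ ‖ContinuousLinearMap.adjoint (Φ x)‖ * ‖f‖ := ContinuousLinearMap.le_opNorm _ _
          _ ≤ ‖Φ‖ * ‖x‖ * ‖f‖ := by
            rw [LinearIsometryEquiv.norm_map]
            gcongr
            exact Φ.le_opNorm x
          _ = ‖Φ‖ * ‖f‖ * ‖x‖ := by ring
  map_add' f g := by ext; simp
  map_smul' c f := by ext; simp

theorem inner_adjointOperator (f : E) (x w : H) : ⟪w, adjointOperator Φ f x⟫ = ⟪Φ x w, f⟫ :=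
  ContinuousLinearMap.adjoint_inner_right (Φ x) w f

theorem adjointOperator_apply_apply (hΦ : ∀ u v, ‖Φ v u‖ = ‖u‖ * ‖v‖) (u v : H) :
    adjointOperator Φ (Φ v u) = (innerSL ℂ v).smulRight u := by
  ext x
  refine ext_inner_left ℂ fun w => ?_
  rw [inner_adjointOperator, inner_apply_apply_of_norm_apply_apply Φ hΦ]
  simp [inner_smul_right, mul_comm]

variable {ι : Type*} (e : HilbertBasis ι ℂ H)

omit [CompleteSpace H] [CompleteSpace E] in
theorem HilbertBasis.continuousLinearMap_ext {F : Type*} [NormedAddCommGroup F] [NormedSpace ℂ F]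
    {S T : H →L[ℂ] F} (h : ∀ i, S (e i) = T (e i)) : S = T := by
  refine ContinuousLinearMap.ext_on (s := Set.range e) ?_ (by rintro _ ⟨i, rfl⟩; exact h i)
  exact Submodule.dense_iff_topologicalClosure_eq_top.mpr e.dense_span

/-- If `Φ` has total range, then `E` is the Hilbert sum of the images of the `Φ (e i)`. -/
theorem isHilbertSum_of_norm_apply_apply (V : ι → H →ₗᵢ[ℂ] E) (hV : ∀ i u, V i u = Φ (e i) u)
    (hΦ : ∀ u v, ‖Φ v u‖ = ‖u‖ * ‖v‖)
    (hspan : (Submodule.span ℂ {f | ∃ u v, f = Φ v u}).topologicalClosure = ⊤) :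
    IsHilbertSum ℂ (fun _ : ι => H) V := by
  refine IsHilbertSum.mk ?_ ?_
  · intro i j hij u v
    rw [hV, hV, inner_apply_apply_of_norm_apply_apply Φ hΦ, e.orthonormal.2 hij.symm, mul_zero]
  · rw [← hspan]
    refine Submodule.topologicalClosure_minimal _ (Submodule.span_le.mpr ?_)
      (Submodule.isClosed_topologicalClosure _)
    rintro _ ⟨u, v, rfl⟩
    set K := (⨆ i, LinearMap.range (V i).toLinearMap).topologicalClosure
    have hclosed : IsClosed {v : H | Φ v u ∈ K} :=
      (Submodule.isClosed_topologicalClosure _).preimage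
        (f := fun v => Φ v u) (by fun_prop)
    have hv : v ∈ closure (Submodule.span ℂ (Set.range e) : Set H) := by
      rw [← Submodule.topologicalClosure_coe, e.dense_span]; trivial
    refine closure_minimal (fun w hw => ?_) hclosed hv
    refine Submodule.span_induction ?_ ?_ ?_ ?_ hw
    · rintro _ ⟨i, rfl⟩
      rw [Set.mem_ofPred_eq, ← hV]
      exact Submodule.le_topologicalClosure _ (Submodule.mem_iSup_of_mem i ⟨u, rfl⟩)
    · simp
    · intro x y _ _ hx hy
      simpa using K.add_mem hx hy
    · intro c x _ hx
      simpa using K.smul_mem _ hx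

/-- If `Φ` has total range, then `E` is isometric to the `ℓ²`-sum of copies of `H`, through
evaluation of `adjointOperator Φ` at the Hilbert basis. -/
theorem exists_linearIsometryEquiv_apply_eq_adjointOperator (hΦ : ∀ u v, ‖Φ v u‖ = ‖u‖ * ‖v‖)
    (hspan : (Submodule.span ℂ {f | ∃ u v, f = Φ v u}).topologicalClosure = ⊤) :
    ∃ W : E ≃ₗᵢ[ℂ] lp (fun _ : ι => H) 2, ∀ f i, W f i = adjointOperator Φ f (e i) := by
  classical
  let V : ι → H →ₗᵢ[ℂ] E := fun i =>
    ⟨(Φ (e i)).toLinearMap, fun u => by simp [hΦ, e.orthonormal.1 i]⟩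
  have hV := isHilbertSum_of_norm_apply_apply Φ e V (fun _ _ => rfl) hΦ hspan
  refine ⟨hV.linearIsometryEquiv, fun f i => ext_inner_left ℂ fun w => ?_⟩
  calc ⟪w, hV.linearIsometryEquiv f i⟫
      = ⟪lp.single (E := fun _ : ι => H) 2 i w, hV.linearIsometryEquiv f⟫ :=
        (lp.inner_single_left (G := fun _ : ι => H) i w _).symm
    _ = ⟪V i w, f⟫ := by
        rw [← hV.linearIsometryEquiv.symm.inner_map_map,
          hV.linearIsometryEquiv_symm_apply_single, LinearIsometryEquiv.symm_apply_apply]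
    _ = ⟪w, adjointOperator Φ f (e i)⟫ := (inner_adjointOperator Φ f (e i) w).symm

theorem tsum_inner_adjointOperator (hΦ : ∀ u v, ‖Φ v u‖ = ‖u‖ * ‖v‖)
    (hspan : (Submodule.span ℂ {f | ∃ u v, f = Φ v u}).topologicalClosure = ⊤) (f g : E) :
    ∑' i, ⟪adjointOperator Φ f (e i), adjointOperator Φ g (e i)⟫ = ⟪f, g⟫ := by
  obtain ⟨W, hW⟩ := exists_linearIsometryEquiv_apply_eq_adjointOperator Φ e hΦ hspan
  simp_rw [← hW]
  rw [← lp.inner_eq_tsum, W.inner_map_map]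

theorem range_adjointOperator (hΦ : ∀ u v, ‖Φ v u‖ = ‖u‖ * ‖v‖)
    (hspan : (Submodule.span ℂ {f | ∃ u v, f = Φ v u}).topologicalClosure = ⊤) :
    Set.range (adjointOperator Φ) = {T : H →L[ℂ] H | Summable fun i => ‖T (e i)‖ ^ 2} := by
  obtain ⟨W, hW⟩ := exists_linearIsometryEquiv_apply_eq_adjointOperator Φ e hΦ hspan
  ext T
  constructor
  · rintro ⟨f, rfl⟩
    have := (lp.memℓp (W f)).summable (by simp)
    simpa [hW] using this
  · intro hT
    have hmem : Memℓp (fun i => T (e i)) 2 := memℓp_gen (by simpa using hT)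
    refine ⟨W.symm ⟨_, hmem⟩, e.continuousLinearMap_ext fun i => ?_⟩
    rw [← hW, LinearIsometryEquiv.apply_symm_apply]

omit [CompleteSpace E] in
/-- An isometry into the Hilbert–Schmidt operators sending `Φ v u` to the rank-one operator
`⟪v, ·⟫ u` is determined by its matrix coefficients. -/
theorem inner_apply_of_tsum_inner_eq (P : E →ₗ[ℂ] (H →L[ℂ] H))
    (hP : ∀ f g, ∑' i, ⟪P f (e i), P g (e i)⟫ = ⟪f, g⟫)
    (hrank : ∀ u v, P (Φ v u) = (innerSL ℂ v).smulRight u) (f : E) (x w : H) :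
    ⟪w, P f x⟫ = ⟪Φ x w, f⟫ := by
  rw [← hP, hrank, ← ContinuousLinearMap.adjoint_inner_left,
    ← e.tsum_inner_mul_inner]
  refine tsum_congr fun i => ?_
  simp [ContinuousLinearMap.adjoint_inner_left]

end Sesquilinear

section Coefficients

variable {X H : Type*} [TopologicalSpace X] [MeasurableSpace X] [BorelSpace X] {μ : Measure X}
  [NormedAddCommGroup H] [InnerProductSpace ℂ H] [CompleteSpace H] {π : X → H →L[ℂ] H}

omit [MeasurableSpace X] [BorelSpace X] in
theorem continuous_coefficient
    (hcont : ∀ u : H, Continuous fun s => ContinuousLinearMap.adjoint (π s) u) (u v : H) :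
    Continuous fun s => ⟪v, π s u⟫ := by
  simp_rw [← ContinuousLinearMap.adjoint_inner_left]
  exact (hcont v).inner continuous_const

theorem memLp_two_coefficient
    (hcont : ∀ u : H, Continuous fun s => ContinuousLinearMap.adjoint (π s) u)
    (hsq : ∀ u v : H, ∫ s, ‖⟪v, π s u⟫‖ ^ 2 ∂μ = ‖u‖ ^ 2 * ‖v‖ ^ 2) (u v : H) :
    MemLp (fun s => ⟪v, π s u⟫) 2 μ := by
  rcases eq_or_ne u 0 with rfl | hu
  · simp
  rcases eq_or_ne v 0 with rfl | hv
  · simp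
  rw [memLp_two_iff_integrable_sq_norm (continuous_coefficient hcont u v).aestronglyMeasurable]
  refine Integrable.of_integral_ne_zero ?_
  rw [hsq]
  positivity

omit [TopologicalSpace X] [BorelSpace X] [CompleteSpace H] in
theorem norm_toLp_coefficient {u v : H} (h : MemLp (fun s => ⟪v, π s u⟫) 2 μ)
    (hsq : ∫ s, ‖⟪v, π s u⟫‖ ^ 2 ∂μ = ‖u‖ ^ 2 * ‖v‖ ^ 2) :
    ‖h.toLp‖ = ‖u‖ * ‖v‖ := by
  have h1 : ⟪h.toLp, h.toLp⟫ = ((‖u‖ ^ 2 * ‖v‖ ^ 2 : ℝ) : ℂ) := by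
    rw [L2.inner_def, ← hsq, ← integral_complex_ofReal]
    refine integral_congr_ae ?_
    filter_upwards [h.coeFn_toLp] with s hs
    rw [hs, inner_self_eq_norm_sq_to_K]
    simp
  rw [inner_self_eq_norm_sq_to_K] at h1
  have h2 : ‖h.toLp‖ ^ 2 = (‖u‖ * ‖v‖) ^ 2 := by
    rw [mul_pow]
    exact Complex.ofReal_injective (by simpa using h1)
  exact (pow_left_inj₀ (norm_nonneg _) (by positivity) two_ne_zero).mp h2

/-- The map `v ↦ u ↦ (s ↦ ⟪v, π s u⟫)` into `L²`. -/
noncomputable def coefficientMap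
    (hcont : ∀ u : H, Continuous fun s => ContinuousLinearMap.adjoint (π s) u)
    (hsq : ∀ u v : H, ∫ s, ‖⟪v, π s u⟫‖ ^ 2 ∂μ = ‖u‖ ^ 2 * ‖v‖ ^ 2) :
    H →L⋆[ℂ] H →L[ℂ] Lp ℂ 2 μ :=
  LinearMap.mkContinuous₂
    (LinearMap.mk₂'ₛₗ (starRingEnd ℂ) (RingHom.id ℂ)
      (fun v u => (memLp_two_coefficient hcont hsq u v).toLp)
      (fun v v' u => by
        rw [← MemLp.toLp_add]
        exact MemLp.toLp_congr _ _ (.of_forall fun s => by simp))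
      (fun c v u => by
        rw [← MemLp.toLp_const_smul]
        exact MemLp.toLp_congr _ _ (.of_forall fun s => by simp [mul_comm]))
      (fun v u u' => by
        rw [← MemLp.toLp_add]
        exact MemLp.toLp_congr _ _ (.of_forall fun s => by simp))
      (fun c v u => by
        rw [← MemLp.toLp_const_smul]
        exact MemLp.toLp_congr _ _ (.of_forall fun s => by simp)))
    1 fun v u => by
      rw [LinearMap.mk₂'ₛₗ_apply, norm_toLp_coefficient _ (hsq u v)]
      linarith

variable (hcont : ∀ u : H, Continuous fun s => ContinuousLinearMap.adjoint (π s) u)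
  (hsq : ∀ u v : H, ∫ s, ‖⟪v, π s u⟫‖ ^ 2 ∂μ = ‖u‖ ^ 2 * ‖v‖ ^ 2)

theorem coeFn_coefficientMap (u v : H) :
    coefficientMap hcont hsq v u =ᵐ[μ] fun s => ⟪v, π s u⟫ :=
  (memLp_two_coefficient hcont hsq u v).coeFn_toLp

theorem norm_coefficientMap (u v : H) : ‖coefficientMap hcont hsq v u‖ = ‖u‖ * ‖v‖ :=
  norm_toLp_coefficient (memLp_two_coefficient hcont hsq u v) (hsq u v)

theorem eq_coefficientMap_iff (u v : H) (f : Lp ℂ 2 μ) :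
    f = coefficientMap hcont hsq v u ↔ f =ᵐ[μ] fun s => ⟪v, π s u⟫ :=
  ⟨fun h => h ▸ coeFn_coefficientMap hcont hsq u v,
    fun h => Lp.ext (h.trans (coeFn_coefficientMap hcont hsq u v).symm)⟩

theorem inner_coefficientMap (u v : H) (f : Lp ℂ 2 μ) :
    ⟪coefficientMap hcont hsq u v, f⟫
      = ∫ s, f s * ⟪v, ContinuousLinearMap.adjoint (π s) u⟫ ∂μ := by
  rw [L2.inner_def]
  refine integral_congr_ae ?_
  filter_upwards [coeFn_coefficientMap hcont hsq v u] with s hs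
  rw [hs, ContinuousLinearMap.adjoint_inner_right, ← inner_conj_symm (π s v) u]
  simp

end Coefficients

/-- Assume the square-integrability condition
`∫ |⟨π(s)u, v⟩|² dμ = ‖u‖²‖v‖²` and the surjectivity assumption (the closed span of the
coefficient functions `s ↦ ⟨π(s)u, v⟩` is all of `L²(Sp, μ)`).  Then there is a unique
unitary `PiA : L²(Sp, μ) → B₂(H)` onto the Hilbert space of Hilbert–Schmidt operators on `H`
(unitarity being expressed, via a Hilbert basis `e` of the separable space `H`, by
preservation of the Hilbert–Schmidt inner product `⟨S, T⟩ = Tr(ST*) = ∑ᵢ ⟪S eᵢ, T eᵢ⟫`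
and by the range being exactly the Hilbert–Schmidt operators) such that `PiA` maps the
function `s ↦ ⟨π(s)u, v⟩` (Mathlib: `s ↦ ⟪v, π s u⟫`) to the rank-one operator
`⟨·, v⟩u = (innerSL ℂ v).smulRight u`.  Moreover
`⟨PiA(f)u', v'⟩ = ∫ f(s) ⟨π(s)* u', v'⟩ dμ(s)` for every `f ∈ L²` and `u', v' ∈ H`. -/
theorem statement4
    {Sp : Type*} [TopologicalSpace Sp] [T2Space Sp] [LocallyCompactSpace Sp]
    [SigmaCompactSpace Sp] [MeasurableSpace Sp] [BorelSpace Sp]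
    (μ : Measure Sp) [μ.Regular]
    {H : Type*} [NormedAddCommGroup H] [InnerProductSpace ℂ H] [CompleteSpace H]
    [TopologicalSpace.SeparableSpace H]
    {ι : Type*} (e : HilbertBasis ι ℂ H)
    (π : Sp → H →L[ℂ] H)
    (hcont : ∀ u : H, Continuous fun s => ContinuousLinearMap.adjoint (π s) u)
    (hsq : ∀ u v : H, ∫ s, ‖⟪v, π s u⟫‖ ^ 2 ∂μ = ‖u‖ ^ 2 * ‖v‖ ^ 2)
    (hsurj : (Submodule.span ℂ {f : Lp ℂ 2 μ | ∃ u v : H,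
        (f : Sp → ℂ) =ᵐ[μ] fun s => ⟪v, π s u⟫}).topologicalClosure = ⊤) :
    ∃ PiA : Lp ℂ 2 μ →ₗ[ℂ] (H →L[ℂ] H),
      -- `PiA` is unitary onto `B₂(H)` and sends coefficient functions to rank-one operators:
      ((∀ f g : Lp ℂ 2 μ, ∑' i, ⟪PiA f (e i), PiA g (e i)⟫ = ⟪f, g⟫) ∧
        (Set.range ⇑PiA = {T : H →L[ℂ] H | Summable fun i => ‖T (e i)‖ ^ 2}) ∧
        (∀ (u v : H) (f : Lp ℂ 2 μ),
          ((f : Sp → ℂ) =ᵐ[μ] fun s => ⟪v, π s u⟫) → PiA f = (innerSL ℂ v).smulRight u)) ∧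
      -- uniqueness among such unitaries:
      (∀ PiB : Lp ℂ 2 μ →ₗ[ℂ] (H →L[ℂ] H),
        ((∀ f g : Lp ℂ 2 μ, ∑' i, ⟪PiB f (e i), PiB g (e i)⟫ = ⟪f, g⟫) ∧
          (Set.range ⇑PiB = {T : H →L[ℂ] H | Summable fun i => ‖T (e i)‖ ^ 2}) ∧
          (∀ (u v : H) (f : Lp ℂ 2 μ),
            ((f : Sp → ℂ) =ᵐ[μ] fun s => ⟪v, π s u⟫) → PiB f = (innerSL ℂ v).smulRight u)) →
        PiB = PiA) ∧
      -- moreover, the weak integral formula holds: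
      (∀ (f : Lp ℂ 2 μ) (u' v' : H),
        ⟪v', PiA f u'⟫ = ∫ s, (f : Sp → ℂ) s * ⟪v', ContinuousLinearMap.adjoint (π s) u'⟫ ∂μ) := by
  have hmem := eq_coefficientMap_iff hcont hsq
  have hnorm := norm_coefficientMap hcont hsq
  simp_rw [← hmem] at hsurj ⊢
  have hrank : ∀ P : Lp ℂ 2 μ →ₗ[ℂ] (H →L[ℂ] H),
      (∀ (u v : H) (f : Lp ℂ 2 μ),
        f = coefficientMap hcont hsq v u → P f = (innerSL ℂ v).smulRight u) ↔
      ∀ u v, P (coefficientMap hcont hsq v u) = (innerSL ℂ v).smulRight u := by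
    simp
  simp_rw [hrank]
  refine ⟨adjointOperator (coefficientMap hcont hsq),
    ⟨tsum_inner_adjointOperator _ e hnorm hsurj, range_adjointOperator _ e hnorm hsurj,
      adjointOperator_apply_apply _ hnorm⟩, ?_, fun f u' v' => ?_⟩
  · rintro PiB ⟨hinner, -, hB⟩
    ext f x
    refine ext_inner_left ℂ fun w => ?_
    rw [inner_apply_of_tsum_inner_eq _ e PiB hinner hB, inner_adjointOperator]
  · rw [inner_adjointOperator, inner_coefficientMap]
end

section
/- Assume the square-integrability condition and the surjectivity assumption, and let Ω be a bounded subset of H. Then Ω is relatively compact in H if and only if for every ε > 0 there exists f ∈ C_c(Σ) such that sup_{u ∈ Ω} ‖Π(f)u − u‖ ≤ ε. -/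
open MeasureTheory ComplexConjugate
open scoped ComplexInnerProductSpace

/-- A sesquilinear map on a complex vector space vanishes if it vanishes on the diagonal. -/
theorem sesquilinear_eq_zero_of_diagonal {V : Type*} [AddCommGroup V] [Module ℂ V]
    (S : V → V → ℂ) (add_left : ∀ x y z, S (x + y) z = S x z + S y z)
    (add_right : ∀ x y z, S x (y + z) = S x y + S x z)
    (smul_left : ∀ (c : ℂ) x y, S (c • x) y = conj c * S x y)
    (smul_right : ∀ (c : ℂ) x y, S x (c • y) = c * S x y)
    (diagonal : ∀ x, S x x = 0) (x y : V) : S x y = 0 := by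
  have h1 := diagonal (x + y)
  have h2 := diagonal (x + Complex.I • y)
  simp only [add_left, add_right, smul_left, smul_right, diagonal, Complex.conj_I] at h1 h2
  linear_combination (1 / 2 : ℂ) * h1 - (Complex.I / 2) * h2 +
    (S x y - S y x) / 2 * Complex.I_sq

section CoefficientFunctions

variable {Sp : Type*} [MeasurableSpace Sp] {μ : Measure Sp}
  {H : Type*} [NormedAddCommGroup H] [InnerProductSpace ℂ H] {π : Sp → H →L[ℂ] H}

/-- The coefficient function `s ↦ ⟪u, π s w⟫` as an element of `L²`. -/
noncomputable def coefficientLp (hmem : ∀ u w : H, MemLp (fun s => ⟪u, π s w⟫) 2 μ) (u w : H) :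
    Lp ℂ 2 μ :=
  (hmem u w).toLp _

variable (hmem : ∀ u w : H, MemLp (fun s => ⟪u, π s w⟫) 2 μ)

theorem coefficientLp_add_left (u v w : H) :
    coefficientLp hmem (u + v) w = coefficientLp hmem u w + coefficientLp hmem v w := by
  rw [coefficientLp, coefficientLp, coefficientLp, ← MemLp.toLp_add]
  congr 1
  ext s
  simp

theorem coefficientLp_add_right (u v w : H) :
    coefficientLp hmem u (v + w) = coefficientLp hmem u v + coefficientLp hmem u w := by
  rw [coefficientLp, coefficientLp, coefficientLp, ← MemLp.toLp_add]
  congr 1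
  ext s
  simp

theorem coefficientLp_smul_left (c : ℂ) (u w : H) :
    coefficientLp hmem (c • u) w = conj c • coefficientLp hmem u w := by
  rw [coefficientLp, coefficientLp, ← MemLp.toLp_const_smul]
  congr 1
  ext s
  simp [mul_comm]

theorem coefficientLp_smul_right (c : ℂ) (u w : H) :
    coefficientLp hmem u (c • w) = c • coefficientLp hmem u w := by
  rw [coefficientLp, coefficientLp, ← MemLp.toLp_const_smul]
  congr 1
  ext s
  simp

theorem inner_coefficientLp_toLp {f : Sp → ℂ} (hf : MemLp f 2 μ) (u w : H) :
    ⟪coefficientLp hmem u w, hf.toLp f⟫ = ∫ s, f s * conj ⟪u, π s w⟫ ∂μ := by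
  rw [L2.inner_def]
  refine integral_congr_ae ?_
  filter_upwards [(hmem u w).coeFn_toLp, hf.coeFn_toLp] with s h1 h2
  rw [coefficientLp, h1, h2, RCLike.inner_apply]



theorem inner_coefficientLp_self
    (hsq : ∀ u v : H, ∫ s, ‖⟪v, π s u⟫‖ ^ 2 ∂μ = ‖u‖ ^ 2 * ‖v‖ ^ 2) (u w : H) :
    ⟪coefficientLp hmem u w, coefficientLp hmem u w⟫ = ((‖u‖ ^ 2 * ‖w‖ ^ 2 : ℝ) : ℂ) := by
  rw [mul_comm, ← hsq w u, ← integral_complex_ofReal]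
  refine (inner_coefficientLp_toLp hmem (hmem u w) u w).trans (integral_congr_ae ?_)
  filter_upwards with s
  rw [Complex.mul_conj, Complex.normSq_eq_norm_sq]

theorem norm_coefficientLp
    (hsq : ∀ u v : H, ∫ s, ‖⟪v, π s u⟫‖ ^ 2 ∂μ = ‖u‖ ^ 2 * ‖v‖ ^ 2) (u w : H) :
    ‖coefficientLp hmem u w‖ = ‖u‖ * ‖w‖ := by
  have h := inner_coefficientLp_self hmem hsq u w
  have h' : ‖coefficientLp hmem u w‖ ^ 2 = (‖u‖ * ‖w‖) ^ 2 := by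
    rw [mul_pow, ← inner_self_eq_norm_sq (𝕜 := ℂ), h]
    exact Complex.ofReal_re _
  exact (pow_left_inj₀ (norm_nonneg _) (by positivity) two_ne_zero).1 h'

/-- The orthogonality relations for coefficient functions. -/
theorem inner_coefficientLp
    (hsq : ∀ u v : H, ∫ s, ‖⟪v, π s u⟫‖ ^ 2 ∂μ = ‖u‖ ^ 2 * ‖v‖ ^ 2) (u w a b : H) :
    ⟪coefficientLp hmem u w, coefficientLp hmem a b⟫ = ⟪w, b⟫ * ⟪a, u⟫ := by
  have right (u w b : H) :
      ⟪coefficientLp hmem u w, coefficientLp hmem u b⟫ = ⟪w, b⟫ * ⟪u, u⟫ := by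
    refine sub_eq_zero.1 (sesquilinear_eq_zero_of_diagonal
      (fun w b => ⟪coefficientLp hmem u w, coefficientLp hmem u b⟫ - ⟪w, b⟫ * ⟪u, u⟫)
      ?_ ?_ ?_ ?_ ?_ w b)
    · intro x y z
      simp only [coefficientLp_add_right, inner_add_left]
      ring
    · intro x y z
      simp only [coefficientLp_add_right, inner_add_right]
      ring
    · intro c x y
      simp only [coefficientLp_smul_right, inner_smul_left]
      ring
    · intro c x y
      simp only [coefficientLp_smul_right, inner_smul_right]
      ring
    · intro x
      rw [inner_coefficientLp_self hmem hsq, inner_self_eq_norm_sq_to_K,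
        inner_self_eq_norm_sq_to_K]
      push_cast
      exact sub_eq_zero.2 (mul_comm _ _)
  refine sub_eq_zero.1 (sesquilinear_eq_zero_of_diagonal
    (fun a u => ⟪coefficientLp hmem u w, coefficientLp hmem a b⟫ - ⟪w, b⟫ * ⟪a, u⟫)
    ?_ ?_ ?_ ?_ ?_ a u)
  · intro x y z
    simp only [coefficientLp_add_left, inner_add_left, inner_add_right]
    ring
  · intro x y z
    simp only [coefficientLp_add_left, inner_add_left, inner_add_right]
    ring
  · intro c x y
    simp only [coefficientLp_smul_left, inner_smul_left, inner_smul_right]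
    ring
  · intro c x y
    simp only [coefficientLp_smul_left, inner_smul_left, inner_smul_right, Complex.conj_conj]
    ring
  · intro x
    exact sub_eq_zero.2 (right x w b)

/-- An element of the span of the coefficient functions is the symbol of a compact operator. -/
theorem exists_isCompactOperator_of_mem_span
    (hsq : ∀ u v : H, ∫ s, ‖⟪v, π s u⟫‖ ^ 2 ∂μ = ‖u‖ ^ 2 * ‖v‖ ^ 2) {G : Lp ℂ 2 μ}
    (hG : G ∈ Submodule.span ℂ {f : Lp ℂ 2 μ | ∃ u v : H,
      (f : Sp → ℂ) =ᵐ[μ] fun s => ⟪v, π s u⟫}) :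
    ∃ P : H →L[ℂ] H, IsCompactOperator P ∧ ∀ u w, ⟪w, P u⟫ = ⟪coefficientLp hmem u w, G⟫ := by
  induction hG using Submodule.span_induction with
  | mem f hf =>
    obtain ⟨b, a, hf⟩ := hf
    have hfG : f = coefficientLp hmem a b := Lp.ext (hf.trans (hmem a b).coeFn_toLp.symm)
    refine ⟨InnerProductSpace.rankOne ℂ b a, ?_, fun u w => ?_⟩
    · exact (isCompactOperator_of_locallyCompactSpace_rng
        (ContinuousLinearMap.toSpanSingleton ℂ b)).comp_clm (innerSL ℂ a)
    · rw [hfG, inner_coefficientLp hmem hsq, InnerProductSpace.rankOne_apply, inner_smul_right,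
        mul_comm]
  | zero => exact ⟨0, isCompactOperator_zero, by simp⟩
  | add f g _ _ hf hg =>
    obtain ⟨P, hP, hPf⟩ := hf
    obtain ⟨Q, hQ, hQg⟩ := hg
    exact ⟨P + Q, hP.add hQ, fun u w => by simp [inner_add_right, hPf, hQg]⟩
  | smul c f _ hf =>
    obtain ⟨P, hP, hPf⟩ := hf
    exact ⟨c • P, hP.smul c, fun u w => by simp [inner_smul_right, hPf]⟩

/-- Orthogonal projections onto finite-dimensional subspaces have a symbol in `L²`. -/
theorem exists_symbol_starProjection
    (hsq : ∀ u v : H, ∫ s, ‖⟪v, π s u⟫‖ ^ 2 ∂μ = ‖u‖ ^ 2 * ‖v‖ ^ 2)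
    (U : Submodule ℂ H) [FiniteDimensional ℂ U] :
    ∃ G : Lp ℂ 2 μ, ∀ u w, ⟪w, U.starProjection u⟫ = ⟪coefficientLp hmem u w, G⟫ := by
  let b := stdOrthonormalBasis ℂ U
  refine ⟨∑ i, coefficientLp hmem (b i) (b i), fun u w => ?_⟩
  rw [b.starProjection_eq_sum_rankOne]
  simp [inner_sum, inner_coefficientLp hmem hsq, mul_comm]

/-- Vectors weakly represented by nearby elements of `L²` are close. -/
theorem norm_sub_le_of_inner_eq
    (hsq : ∀ u v : H, ∫ s, ‖⟪v, π s u⟫‖ ^ 2 ∂μ = ‖u‖ ^ 2 * ‖v‖ ^ 2) {F G : Lp ℂ 2 μ} {u x y : H}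
    (hx : ∀ w, ⟪w, x⟫ = ⟪coefficientLp hmem u w, F⟫)
    (hy : ∀ w, ⟪w, y⟫ = ⟪coefficientLp hmem u w, G⟫) : ‖x - y‖ ≤ ‖F - G‖ * ‖u‖ := by
  have h : ‖⟪x - y, x - y⟫‖ ≤ ‖coefficientLp hmem u (x - y)‖ * ‖F - G‖ := by
    rw [inner_sub_right, hx, hy, ← inner_sub_right]
    exact norm_inner_le_norm _ _
  rw [norm_coefficientLp hmem hsq, inner_self_eq_norm_sq_to_K, norm_pow, RCLike.norm_ofReal,
    abs_norm] at h
  rcases (norm_nonneg (x - y)).eq_or_lt with h0 | h0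
  · rw [← h0]
    positivity
  · nlinarith

end CoefficientFunctions

section Regularity

variable {Sp : Type*} [TopologicalSpace Sp] [MeasurableSpace Sp] [BorelSpace Sp] {μ : Measure Sp}
  {H : Type*} [NormedAddCommGroup H] [InnerProductSpace ℂ H] [CompleteSpace H]
  {π : Sp → H →L[ℂ] H}

theorem memLp_inner_of_integral_norm_sq
    (hcont : ∀ u : H, Continuous fun s => ContinuousLinearMap.adjoint (π s) u)
    (hsq : ∀ u v : H, ∫ s, ‖⟪v, π s u⟫‖ ^ 2 ∂μ = ‖u‖ ^ 2 * ‖v‖ ^ 2) (u w : H) :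
    MemLp (fun s => ⟪u, π s w⟫) 2 μ := by
  have hc : Continuous fun s => ⟪u, π s w⟫ := by
    simp_rw [← ContinuousLinearMap.adjoint_inner_left]
    exact (hcont u).inner continuous_const
  rw [memLp_two_iff_integrable_sq_norm hc.aestronglyMeasurable]
  by_contra hi
  have h0 := (hsq w u).symm.trans (integral_undef hi)
  rcases mul_eq_zero.1 h0 with h | h
  · have hw : w = 0 := by simpa using h
    simp [hw] at hi
  · have hu : u = 0 := by simpa using h
    simp [hu] at hi

theorem inner_integral_smul_adjoint [IsFiniteMeasureOnCompacts μ]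
    (hcont : ∀ u : H, Continuous fun s => ContinuousLinearMap.adjoint (π s) u)
    (hmem : ∀ u w : H, MemLp (fun s => ⟪u, π s w⟫) 2 μ)
    {f : Sp → ℂ} (hf : Continuous f) (hfc : HasCompactSupport f) (hf2 : MemLp f 2 μ) (u w : H) :
    ⟪w, ∫ s, f s • ContinuousLinearMap.adjoint (π s) u ∂μ⟫ =
      ⟪coefficientLp hmem u w, hf2.toLp f⟫ := by
  have hi : Integrable (fun s => f s • ContinuousLinearMap.adjoint (π s) u) μ :=
    (hf.smul (hcont u)).integrable_of_hasCompactSupport hfc.smul_right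
  rw [inner_coefficientLp_toLp, ← integral_inner hi]
  refine integral_congr_ae (.of_forall fun s => ?_)
  simp only [inner_smul_right, ContinuousLinearMap.adjoint_inner_right, inner_conj_symm]

end Regularity

/-- A set uniformly approximated by totally bounded images is totally bounded. -/
theorem totallyBounded_of_forall_exists_dist_le {X : Type*} [PseudoMetricSpace X] {s : Set X}
    (h : ∀ ε > (0 : ℝ), ∃ g : X → X, TotallyBounded (g '' s) ∧ ∀ x ∈ s, dist (g x) x ≤ ε) :
    TotallyBounded s := by
  rw [Metric.totallyBounded_iff]
  intro ε hε
  obtain ⟨g, hg, hd⟩ := h (ε / 2) (half_pos hε)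
  obtain ⟨t, ht, hcov⟩ := Metric.totallyBounded_iff.1 hg (ε / 2) (half_pos hε)
  refine ⟨t, ht, fun x hx => ?_⟩
  obtain ⟨y, hy, hxy⟩ := Set.mem_iUnion₂.1 (hcov (Set.mem_image_of_mem g hx))
  refine Set.mem_iUnion₂.2 ⟨y, hy, Metric.mem_ball.2 ?_⟩
  have := Metric.mem_ball.1 hxy
  linarith [dist_triangle_left x y (g x), hd x hx]

/-- A totally bounded set is uniformly close to its projection onto some finite-dimensional
subspace. -/
theorem TotallyBounded.exists_finiteDimensional_norm_starProjection_sub_le {H : Type*}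
    [NormedAddCommGroup H] [InnerProductSpace ℂ H] {Ω : Set H} (hΩ : TotallyBounded Ω) {ε : ℝ}
    (hε : 0 < ε) : ∃ (U : Submodule ℂ H) (_ : FiniteDimensional ℂ U),
      ∀ u ∈ Ω, ‖U.starProjection u - u‖ ≤ ε := by
  obtain ⟨t, ht, hcov⟩ := Metric.totallyBounded_iff.1 hΩ ε hε
  have hfin : FiniteDimensional ℂ (Submodule.span ℂ t) := FiniteDimensional.span_of_finite ℂ ht
  refine ⟨Submodule.span ℂ t, hfin, fun u hu => ?_⟩
  obtain ⟨y, hy, huy⟩ := Set.mem_iUnion₂.1 (hcov hu)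
  rw [norm_sub_rev, Submodule.starProjection_minimal]
  refine (ciInf_le ⟨0, Set.forall_mem_range.mpr fun _ => norm_nonneg _⟩
    (⟨y, Submodule.subset_span hy⟩ : Submodule.span ℂ t)).trans ?_
  rw [← dist_eq_norm]
  exact (Metric.mem_ball.1 huy).le

/-- Assume the square-integrability condition and the surjectivity
assumption for `π : Sp → B(H)`.  A bounded subset `Ω ⊆ H` is relatively compact if and only
if for every `ε > 0` there exists `f ∈ C_c(Sp)` such that
`sup_{u ∈ Ω} ‖Π(f)u − u‖ ≤ ε`, where `Π(f)u = ∫ f(s) π(s)* u dμ(s)` (Bochner integral). -/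
theorem statement5
    {Sp : Type*} [TopologicalSpace Sp] [T2Space Sp] [LocallyCompactSpace Sp]
    [SigmaCompactSpace Sp] [MeasurableSpace Sp] [BorelSpace Sp]
    (μ : Measure Sp) [μ.Regular]
    {H : Type*} [NormedAddCommGroup H] [InnerProductSpace ℂ H] [CompleteSpace H]
    [TopologicalSpace.SeparableSpace H]
    (π : Sp → H →L[ℂ] H)
    (hcont : ∀ u : H, Continuous fun s => ContinuousLinearMap.adjoint (π s) u)
    (hsq : ∀ u v : H, ∫ s, ‖⟪v, π s u⟫‖ ^ 2 ∂μ = ‖u‖ ^ 2 * ‖v‖ ^ 2)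
    (hsurj : (Submodule.span ℂ {f : Lp ℂ 2 μ | ∃ u v : H,
        (f : Sp → ℂ) =ᵐ[μ] fun s => ⟪v, π s u⟫}).topologicalClosure = ⊤)
    (Ω : Set H) (hΩ : Bornology.IsBounded Ω) :
    IsCompact (closure Ω) ↔
      ∀ ε > (0:ℝ), ∃ f : Sp → ℂ, Continuous f ∧ HasCompactSupport f ∧
        ∀ u ∈ Ω, ‖(∫ s, f s • ContinuousLinearMap.adjoint (π s) u ∂μ) - u‖ ≤ ε := by
  have hmem := memLp_inner_of_integral_norm_sq hcont hsq
  obtain ⟨R, hR, hΩR⟩ := hΩ.exists_pos_norm_le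
  constructor
  · intro hK ε hε
    obtain ⟨U, _, hU⟩ := (hK.totallyBounded.subset subset_closure)
      |>.exists_finiteDimensional_norm_starProjection_sub_le (half_pos hε)
    obtain ⟨G, hG⟩ := exists_symbol_starProjection hmem hsq U
    have hδ : 0 < ε / 2 / R := by positivity
    obtain ⟨f, hfc, hfG, hf, hf2⟩ := (Lp.memLp G).exists_hasCompactSupport_eLpNorm_sub_le
      ENNReal.ofNat_ne_top (ENNReal.ofReal_pos.2 hδ).ne'
    have hd : ‖hf2.toLp f - G‖ ≤ ε / 2 / R := by
      rw [norm_sub_rev, ← Lp.toLp_coeFn G (Lp.memLp G), ← MemLp.toLp_sub, Lp.norm_toLp]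
      exact ENNReal.toReal_le_of_le_ofReal hδ.le hfG
    refine ⟨f, hf, hfc, fun u hu => ?_⟩
    have h1 := norm_sub_le_of_inner_eq hmem hsq
      (inner_integral_smul_adjoint hcont hmem hf hfc hf2 u) (hG u)
    have h2 : ‖hf2.toLp f - G‖ * ‖u‖ ≤ ε / 2 / R * R := by gcongr; exact hΩR u hu
    rw [div_mul_cancel₀ _ hR.ne'] at h2
    linarith [norm_sub_le_norm_sub_add_norm_sub
      (∫ s, f s • ContinuousLinearMap.adjoint (π s) u ∂μ) (U.starProjection u) u, hU u hu]
  · intro h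
    refine TotallyBounded.isCompact_of_isClosed (TotallyBounded.closure ?_) isClosed_closure
    refine totallyBounded_of_forall_exists_dist_le fun ε hε => ?_
    obtain ⟨f, hf, hfc, hfΩ⟩ := h (ε / 2) (half_pos hε)
    have hf2 : MemLp f 2 μ := hf.memLp_of_hasCompactSupport hfc
    have hδ : 0 < ε / 2 / R := by positivity
    obtain ⟨G, hG, hfG⟩ := Metric.mem_closure_iff.1
      ((Submodule.dense_iff_topologicalClosure_eq_top.2 hsurj) (hf2.toLp f)) _ hδ
    obtain ⟨P, hP, hPG⟩ := exists_isCompactOperator_of_mem_span hmem hsq hG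
    refine ⟨P, ?_, fun u hu => ?_⟩
    · obtain ⟨K, hK, hPK⟩ := hP.image_subset_compact_of_bounded hΩ
      exact hK.totallyBounded.subset hPK
    · have h1 := norm_sub_le_of_inner_eq hmem hsq
        (inner_integral_smul_adjoint hcont hmem hf hfc hf2 u) (hPG u)
      rw [dist_eq_norm] at hfG ⊢
      have h2 : ‖hf2.toLp f - G‖ * ‖u‖ ≤ ε / 2 / R * R := by gcongr; exact hΩR u hu
      rw [div_mul_cancel₀ _ hR.ne'] at h2
      rw [norm_sub_rev] at h1
      linarith [norm_sub_le_norm_sub_add_norm_sub (P u)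
        (∫ s, f s • ContinuousLinearMap.adjoint (π s) u ∂μ) u, hfΩ u hu]
end

section
/- Assume the square-integrability condition and the surjectivity assumption. If Ω is a bounded, relatively compact subset of H, then for every s₀ ∈ Σ one has lim_{s → s₀} sup_{u ∈ Ω} ‖π(s)*u − π(s₀)*u‖ = 0; that is, the family of maps {s ↦ π(s)*u : u ∈ Ω} from Σ to H is equicontinuous at every point of Σ. -/
open MeasureTheory ComplexConjugate
open scoped ComplexInnerProductSpace Topology

/-- A strongly continuous family of operators on a locally compact space is equicontinuous
on totally bounded sets of vectors. -/
theorem eventually_forall_norm_sub_le_of_totallyBounded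
    {X 𝕜 E F : Type*} [TopologicalSpace X] [LocallyCompactSpace X] [NontriviallyNormedField 𝕜]
    [NormedAddCommGroup E] [NormedSpace 𝕜 E] [CompleteSpace E]
    [NormedAddCommGroup F] [NormedSpace 𝕜 F]
    (T : X → E →L[𝕜] F) (hT : ∀ u, Continuous fun s => T s u)
    {Ω : Set E} (hΩ : TotallyBounded Ω) (s₀ : X) {ε : ℝ} (hε : 0 < ε) :
    ∀ᶠ s in 𝓝 s₀, ∀ u ∈ Ω, ‖T s u - T s₀ u‖ ≤ ε := by
  obtain ⟨K, hK, hKs⟩ := exists_compact_mem_nhds s₀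
  obtain ⟨C, hC⟩ : ∃ C, ∀ s : K, ‖T s‖ ≤ C := by
    refine banach_steinhaus fun u => ?_
    obtain ⟨C, hC⟩ := hK.exists_bound_of_continuousOn (hT u).continuousOn
    exact ⟨C, fun s => hC s s.2⟩
  have hC₀ : 0 ≤ C := (norm_nonneg _).trans (hC ⟨s₀, mem_of_mem_nhds hKs⟩)
  have hδ : 0 < ε / (4 * (C + 1)) := by positivity
  obtain ⟨t, ht, hcover⟩ := Metric.totallyBounded_iff.1 hΩ _ hδ
  have hnear : ∀ᶠ s in 𝓝 s₀, ∀ v ∈ t, ‖T s v - T s₀ v‖ < ε / 2 := by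
    refine (Filter.eventually_all_finite ht).2 fun v _ => ?_
    have := Metric.tendsto_nhds.1 ((hT v).tendsto s₀) (ε / 2) (by positivity)
    simpa only [dist_eq_norm] using this
  filter_upwards [hnear, hKs] with s hs hsK u hu
  obtain ⟨v, hv, huv⟩ := Set.mem_iUnion₂.1 (hcover hu)
  rw [Metric.mem_ball, dist_eq_norm] at huv
  have bound : ∀ r ∈ K, ‖T r (u - v)‖ ≤ ε / 4 := fun r hr => calc
    ‖T r (u - v)‖ ≤ (C + 1) * (ε / (4 * (C + 1))) :=
      (T r).le_of_opNorm_le_of_le ((hC ⟨r, hr⟩).trans (by linarith)) huv.le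
    _ = ε / 4 := by field_simp
  calc ‖T s u - T s₀ u‖
      = ‖T s (u - v) - T s₀ (u - v) + (T s v - T s₀ v)‖ := by
        congr 1; simp only [map_sub]; abel
    _ ≤ ‖T s (u - v)‖ + ‖T s₀ (u - v)‖ + ‖T s v - T s₀ v‖ :=
        (norm_add_le _ _).trans (by gcongr; exact norm_sub_le _ _)
    _ ≤ ε := by
        linarith [bound s hsK, bound s₀ (mem_of_mem_nhds hKs), hs v hv]

/-- Assume the square-integrability condition and the surjectivity
assumption for `π : Sp → B(H)`.  If `Ω ⊆ H` is bounded and relatively compact, then for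
every `s₀ ∈ Sp` one has `lim_{s → s₀} sup_{u ∈ Ω} ‖π(s)*u − π(s₀)*u‖ = 0`; i.e. the family
of maps `{s ↦ π(s)*u : u ∈ Ω}` is equicontinuous at every point of `Sp`. -/
theorem statement6
    {Sp : Type*} [TopologicalSpace Sp] [T2Space Sp] [LocallyCompactSpace Sp]
    [SigmaCompactSpace Sp] [MeasurableSpace Sp] [BorelSpace Sp]
    (μ : Measure Sp) [μ.Regular]
    {H : Type*} [NormedAddCommGroup H] [InnerProductSpace ℂ H] [CompleteSpace H]
    [TopologicalSpace.SeparableSpace H]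
    (π : Sp → H →L[ℂ] H)
    (hcont : ∀ u : H, Continuous fun s => ContinuousLinearMap.adjoint (π s) u)
    (hsq : ∀ u v : H, ∫ s, ‖⟪v, π s u⟫‖ ^ 2 ∂μ = ‖u‖ ^ 2 * ‖v‖ ^ 2)
    (hsurj : (Submodule.span ℂ {f : Lp ℂ 2 μ | ∃ u v : H,
        (f : Sp → ℂ) =ᵐ[μ] fun s => ⟪v, π s u⟫}).topologicalClosure = ⊤)
    (Ω : Set H) (hΩ : Bornology.IsBounded Ω) (hcp : IsCompact (closure Ω)) :
    ∀ s₀ : Sp, ∀ ε > (0:ℝ), ∀ᶠ s in 𝓝 s₀, ∀ u ∈ Ω,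
      ‖ContinuousLinearMap.adjoint (π s) u - ContinuousLinearMap.adjoint (π s₀) u‖ ≤ ε := by
  intro s₀ ε hε
  exact eventually_forall_norm_sub_le_of_totallyBounded
    (fun s => ContinuousLinearMap.adjoint (π s)) hcont
    (hcp.totallyBounded.subset subset_closure) s₀ hε
end

section
/- Assume the square-integrability condition, let Ω be a bounded subset of H, and let s₀ be a point of the support of μ. If lim_{s → s₀} sup_{u ∈ Ω} ‖π(s)*u − π(s₀)*u‖ = 0, then for every ε > 0 there exists g ∈ C_c(Σ) with g ≥ 0 and ∫_Σ g dμ = 1 such that sup_{u ∈ Ω} ‖Π(g)u − π(s₀)*u‖ ≤ ε. -/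
open MeasureTheory ComplexConjugate
open scoped ComplexInnerProductSpace Topology

/-- At a point of the support of a Radon measure, every open neighborhood carries a continuous
compactly supported probability density. -/
lemma exists_continuous_density_of_mem_isOpen
    {X : Type*} [TopologicalSpace X] [T2Space X] [LocallyCompactSpace X]
    [MeasurableSpace X] [BorelSpace X] (μ : Measure X) [IsFiniteMeasureOnCompacts μ]
    {x₀ : X} (hx₀ : ∀ U ∈ 𝓝 x₀, μ U ≠ 0) {U : Set X} (hU : IsOpen U) (hxU : x₀ ∈ U) :
    ∃ g : X → ℝ, Continuous g ∧ HasCompactSupport g ∧ (∀ x, 0 ≤ g x) ∧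
      (∫ x, g x ∂μ) = 1 ∧ ∀ x ∉ U, g x = 0 := by
  obtain ⟨f, hf_one, hf_zero, hf_supp, hf_Icc⟩ :=
    exists_continuous_one_zero_of_isCompact (isCompact_singleton (x := x₀)) hU.isClosed_compl
      (by simpa using hxU)
  have hf_nonneg : ∀ x, 0 ≤ f x := fun x => (hf_Icc x).1
  have hf_int : Integrable f μ := f.continuous.integrable_of_hasCompactSupport hf_supp
  have hf_pos : 0 < ∫ x, f x ∂μ := by
    rw [integral_pos_iff_support_of_nonneg hf_nonneg hf_int]
    refine pos_iff_ne_zero.mpr (hx₀ _ (f.continuous.isOpen_support.mem_nhds ?_))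
    have h : f x₀ = 1 := hf_one rfl
    simp [h]
  refine ⟨fun x => (∫ y, f y ∂μ)⁻¹ * f x, by fun_prop, hf_supp.mul_left,
    fun x => mul_nonneg (inv_nonneg.mpr hf_pos.le) (hf_nonneg x), ?_, fun x hx => ?_⟩
  · rw [integral_const_mul, inv_mul_cancel₀ hf_pos.ne']
  · have h : f x = 0 := hf_zero hx
    simp [h]

/-- Averaging `F` against a probability density changes the distance to `a` by no more than the
deviation of `F` from `a` on the support of the density. -/
lemma norm_integral_smul_sub_le_of_density
    {X : Type*} [MeasurableSpace X] {μ : Measure X}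
    {E : Type*} [NormedAddCommGroup E] [NormedSpace ℝ E] [CompleteSpace E]
    {g : X → ℝ} (hg_nonneg : ∀ x, 0 ≤ g x) (hg_int : Integrable g μ) (hg_one : ∫ x, g x ∂μ = 1)
    {F : X → E} (hF : Integrable (fun x => g x • F x) μ) {a : E} {ε : ℝ}
    (hdev : ∀ x, g x ≠ 0 → ‖F x - a‖ ≤ ε) :
    ‖(∫ x, g x • F x ∂μ) - a‖ ≤ ε := by
  have ha : ∫ x, g x • a ∂μ = a := by rw [integral_smul_const, hg_one, one_smul]
  calc ‖(∫ x, g x • F x ∂μ) - a‖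
      = ‖∫ x, (g x • F x - g x • a) ∂μ‖ := by
        rw [integral_sub hF (hg_int.smul_const a), ha]
    _ ≤ ∫ x, g x * ε ∂μ := by
        refine norm_integral_le_of_norm_le (hg_int.mul_const ε) (ae_of_all _ fun x => ?_)
        rw [← smul_sub, norm_smul, Real.norm_of_nonneg (hg_nonneg x)]
        by_cases hx : g x = 0
        · simp [hx]
        · exact mul_le_mul_of_nonneg_left (hdev x hx) (hg_nonneg x)
    _ = ε := by rw [integral_mul_const, hg_one, one_mul]

/-- Assume the square-integrability condition for `π : Sp → B(H)`, let
`Ω ⊆ H` be bounded and let `s₀` be a point of the support of `μ` (every neighborhood of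
`s₀` has nonzero measure).  If `lim_{s → s₀} sup_{u ∈ Ω} ‖π(s)*u − π(s₀)*u‖ = 0`, then for
every `ε > 0` there exists `g ∈ C_c(Sp)` with `g ≥ 0` and `∫ g dμ = 1` such that
`sup_{u ∈ Ω} ‖Π(g)u − π(s₀)*u‖ ≤ ε`, where `Π(g)u = ∫ g(s) π(s)* u dμ(s)`. -/
theorem statement7
    {Sp : Type*} [TopologicalSpace Sp] [T2Space Sp] [LocallyCompactSpace Sp]
    [SigmaCompactSpace Sp] [MeasurableSpace Sp] [BorelSpace Sp]
    (μ : Measure Sp) [μ.Regular]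
    {H : Type*} [NormedAddCommGroup H] [InnerProductSpace ℂ H] [CompleteSpace H]
    [TopologicalSpace.SeparableSpace H]
    (π : Sp → H →L[ℂ] H)
    (hcont : ∀ u : H, Continuous fun s => ContinuousLinearMap.adjoint (π s) u)
    (hsq : ∀ u v : H, ∫ s, ‖⟪v, π s u⟫‖ ^ 2 ∂μ = ‖u‖ ^ 2 * ‖v‖ ^ 2)
    (Ω : Set H) (hΩ : Bornology.IsBounded Ω)
    (s₀ : Sp) (hs₀ : ∀ U ∈ 𝓝 s₀, μ U ≠ 0)
    (hlim : ∀ ε > (0:ℝ), ∀ᶠ s in 𝓝 s₀, ∀ u ∈ Ω,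
      ‖ContinuousLinearMap.adjoint (π s) u - ContinuousLinearMap.adjoint (π s₀) u‖ ≤ ε) :
    ∀ ε > (0:ℝ), ∃ g : Sp → ℝ, Continuous g ∧ HasCompactSupport g ∧ (∀ s, 0 ≤ g s) ∧
      (∫ s, g s ∂μ) = 1 ∧
      ∀ u ∈ Ω,
        ‖(∫ s, g s • ContinuousLinearMap.adjoint (π s) u ∂μ) -
          ContinuousLinearMap.adjoint (π s₀) u‖ ≤ ε := by
  intro ε hε
  obtain ⟨U, hU, hU_open, hsU⟩ := eventually_nhds_iff.mp (hlim ε hε)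
  obtain ⟨g, hg_cont, hg_supp, hg_nonneg, hg_one, hg_zero⟩ :=
    exists_continuous_density_of_mem_isOpen μ hs₀ hU_open hsU
  refine ⟨g, hg_cont, hg_supp, hg_nonneg, hg_one, fun u hu => ?_⟩
  refine norm_integral_smul_sub_le_of_density hg_nonneg
    (hg_cont.integrable_of_hasCompactSupport hg_supp) hg_one
    ((hg_cont.smul (hcont u)).integrable_of_hasCompactSupport hg_supp.smul_right)
    fun s hs => hU s ?_ u hu
  exact not_imp_comm.mp (hg_zero s) hs
end

section
/- Let H be an infinite-dimensional separable complex Hilbert space with orthonormal basis {e_j : j ∈ ℕ}, and for each j let S_j := ⟨·, e_j⟩ e₁ (the rank-one operator x ↦ ⟨x, e_j⟩ e₁). Then the family ℒ := {S_j : j ∈ ℕ} is collectively compact, but the family of adjoints ℒ* = {S_j* = ⟨·, e₁⟩ e_j : j ∈ ℕ} is not collectively compact; in particular, ℒ consists of compact operators, is collectively compact, yet is not relatively compact in B(H) for the operator norm (indeed ‖S_j − S_k‖ = √2 for j ≠ k). -/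
open scoped ComplexInnerProductSpace

/-- A relatively compact set contains no sequence whose distinct terms are uniformly
separated. -/
theorem not_isCompact_closure_of_separated_seq {X : Type*} [PseudoMetricSpace X] {s : Set X}
    {u : ℕ → X} {ε : ℝ} (hε : 0 < ε) (hu : ∀ n, u n ∈ s)
    (hsep : ∀ m n, m ≠ n → ε ≤ dist (u m) (u n)) : ¬ IsCompact (closure s) := by
  intro hs
  obtain ⟨a, -, φ, hφ, hlim⟩ := hs.tendsto_subseq fun n => subset_closure (hu n)
  obtain ⟨N, hN⟩ := Metric.cauchySeq_iff.1 hlim.cauchySeq ε hε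
  exact (hN N le_rfl (N + 1) N.le_succ).not_ge
    (hsep _ _ (hφ.injective.ne N.succ_ne_self.symm))

/-- The set of multiples of a fixed vector by scalars of norm at most one is compact. -/
theorem isCompact_image_smul_closedBall (𝕜 : Type*) [RCLike 𝕜] {E : Type*} [NormedAddCommGroup E]
    [NormedSpace 𝕜 E] (v : E) : IsCompact ((fun c : 𝕜 => c • v) '' Metric.closedBall 0 1) :=
  (isCompact_closedBall 0 1).image (by fun_prop)

/-- The rank-one operator `y ↦ ⟪x, y⟫ • v` with `x` a unit vector maps the closed unit ball
into the multiples of `v` by scalars of norm at most one. -/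
theorem smulRight_innerSL_mem_image_smul {𝕜 H : Type*} [RCLike 𝕜]
    [NormedAddCommGroup H] [InnerProductSpace 𝕜 H] {x : H} (hx : ‖x‖ = 1) (v : H) {y : H}
    (hy : y ∈ Metric.closedBall (0 : H) 1) :
    (innerSL 𝕜 x).smulRight v y ∈ (fun c : 𝕜 => c • v) '' Metric.closedBall 0 1 := by
  refine ⟨inner 𝕜 x y, ?_, by simp⟩
  have h := norm_inner_le_norm (𝕜 := 𝕜) x y
  rw [mem_closedBall_zero_iff] at hy ⊢
  rw [hx, one_mul] at h
  exact h.trans hy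

/-- Distinct members of an orthonormal family are at distance `√2`. -/
theorem Orthonormal.norm_sub_eq_sqrt_two {𝕜 ι H : Type*} [RCLike 𝕜]
    [NormedAddCommGroup H] [InnerProductSpace 𝕜 H] {e : ι → H} (he : Orthonormal 𝕜 e)
    {j k : ι} (hjk : j ≠ k) : ‖e j - e k‖ = √2 := by
  have h := norm_sub_sq (𝕜 := 𝕜) (e j) (e k)
  rw [he.2 hjk, he.1, he.1] at h
  rw [eq_comm, Real.sqrt_eq_iff_eq_sq (by norm_num) (norm_nonneg _), h]
  norm_num

/-- Let `H` be an infinite-dimensional separable complex Hilbert space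
with orthonormal (Hilbert) basis `{e j : j ∈ ℕ}`, and let `S j := ⟨·, e j⟩ e 0` be the
rank-one operator `x ↦ ⟪e j, x⟫ • e 0` (Mathlib: `(innerSL ℂ (e j)).smulRight (e 0)`).
Then the family `ℒ = {S j}` consists of compact operators and is collectively compact
(the union of the images of the closed unit ball is relatively compact), its adjoints are
`S j * = ⟨·, e 0⟩ e j` and the family of adjoints is *not* collectively compact; in
particular `ℒ` is not relatively compact in `B(H)` (indeed `‖S j − S k‖ = √2` for
`j ≠ k`). -/
theorem statement11
    {H : Type*} [NormedAddCommGroup H] [InnerProductSpace ℂ H] [CompleteSpace H]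
    [TopologicalSpace.SeparableSpace H]
    (e : HilbertBasis ℕ ℂ H)
    (S : ℕ → H →L[ℂ] H)
    (hS : ∀ j, S j = (innerSL ℂ (e j)).smulRight (e 0)) :
    -- each `S j` is compact
    (∀ j, IsCompactOperator ⇑(S j)) ∧
    -- `ℒ` is collectively compact
    IsCompact (closure (⋃ j, S j '' Metric.closedBall (0:H) 1)) ∧
    -- the adjoints are the rank-one operators `x ↦ ⟪e 0, x⟫ • e j`
    (∀ j, ContinuousLinearMap.adjoint (S j) = (innerSL ℂ (e 0)).smulRight (e j)) ∧
    -- `ℒ*` is not collectively compact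
    ¬ IsCompact
      (closure (⋃ j, (ContinuousLinearMap.adjoint (S j)) '' Metric.closedBall (0:H) 1)) ∧
    -- `ℒ` is not relatively compact in `B(H)` for the operator norm
    ¬ IsCompact (closure (Set.range S)) ∧
    -- indeed `‖S j − S k‖ = √2` for `j ≠ k`
    (∀ j k, j ≠ k → ‖S j - S k‖ = Real.sqrt 2) := by
  have he := e.orthonormal
  have hadj : ∀ j, ContinuousLinearMap.adjoint (S j) = (innerSL ℂ (e 0)).smulRight (e j) :=
    fun j => by rw [hS]; exact InnerProductSpace.adjoint_rankOne _ _
  have hmem : ∀ j, ∀ y ∈ Metric.closedBall (0 : H) 1,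
      S j y ∈ (fun c : ℂ => c • e 0) '' Metric.closedBall 0 1 := fun j y hy => by
    rw [hS]
    exact smulRight_innerSL_mem_image_smul (he.1 j) _ hy
  have hK := isCompact_image_smul_closedBall ℂ (e 0)
  have hnorm : ∀ j k, j ≠ k → ‖S j - S k‖ = √2 := fun j k hjk => by
    have h : S j - S k = (innerSL ℂ (e j - e k)).smulRight (e 0) := by
      ext x
      simp [hS, sub_smul]
    rw [h, ContinuousLinearMap.norm_smulRight_apply, innerSL_apply_norm, he.1, mul_one,
      he.norm_sub_eq_sqrt_two hjk]
  refine ⟨fun j => ⟨_, hK, ?_⟩, ?_, hadj, ?_, ?_, hnorm⟩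
  · exact Filter.mem_of_superset (Metric.closedBall_mem_nhds 0 one_pos) (hmem j)
  · refine hK.closure_of_subset (Set.iUnion_subset fun j => ?_)
    rintro _ ⟨y, hy, rfl⟩
    exact hmem j y hy
  · refine not_isCompact_closure_of_separated_seq (u := e) (ε := √2) (by positivity)
      (fun j => Set.mem_iUnion.2 ⟨j, e 0, by simp [he.1], ?_⟩) fun j k hjk => ?_
    · simp [hadj, he.1]
    · rw [dist_eq_norm, he.norm_sub_eq_sqrt_two hjk]
  · refine not_isCompact_closure_of_separated_seq (u := S) (ε := √2) (by positivity)
      (fun j => Set.mem_range_self j) fun j k hjk => ?_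
    rw [dist_eq_norm, hnorm j k hjk]
end
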